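/- arXiv:2507.02084 — 8 statements merged into one kernel-verified Lean document; each statement's English description precedes it below -/
import Mathlib

section
/- Let A ∈ ℝ^{M×N} with N = 2m+1 odd, y ∈ ℝ^M, μ > 0 and γ > 1, and let x* ∈ ℝ^N be a fixed point of the adaptive ISTA iteration with MAD thresholding, i.e. x* = soft(z*, γ·med(|z*|)) with z* = x* − μAᵀ(Ax* − y). Set λ* = γ·med(|Aᵀ(Ax* − y)|). Then for every index i: if x*_i ≠ 0 then −[Aᵀ(Ax* − y)]_i = λ*·sign(x*_i), and if x*_i = 0 then |[Aᵀ(Ax* − y)]_i| ≤ λ*. In particular this condition does not involve the step size μ. -/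
open Matrix

noncomputable def soft {N : ℕ} (z : Fin N → ℝ) (τ : ℝ) : Fin N → ℝ :=
  fun i => Real.sign (z i) * max (|z i| - τ) 0

/-- The median of a vector of odd length `2*m+1`: its `(m+1)`-th smallest entry. -/
noncomputable def med {m : ℕ} (v : Fin (2 * m + 1) → ℝ) : ℝ :=
  ((Finset.univ.val.map v).sort (· ≤ ·)).getD m 0

theorem Monotone.med_comp {m : ℕ} {f : ℝ → ℝ} (hf : Monotone f) (v : Fin (2 * m + 1) → ℝ) :
    med (fun i => f (v i)) = f (med v) := by
  have hsort : (Finset.univ.val.map fun i => f (v i)).sort (· ≤ ·) =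
      ((Finset.univ.val.map v).sort (· ≤ ·)).map f := by
    apply List.Perm.eq_of_pairwise' (r := (· ≤ ·))
    · exact Multiset.pairwise_sort _ _
    · exact (Multiset.pairwise_sort (Finset.univ.val.map v) (· ≤ ·)).map f fun _ _ h => hf h
    · rw [← Multiset.coe_eq_coe, Multiset.sort_eq, ← Multiset.map_coe, Multiset.sort_eq,
        Multiset.map_map]
      rfl
  have hlen : m < ((Finset.univ.val.map v).sort (· ≤ ·)).length := by
    simp
    omega
  unfold med
  rw [hsort, List.getD_eq_getElem _ _ (by simpa using hlen), List.getD_eq_getElem _ _ hlen,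
    List.getElem_map]

theorem med_abs_nonneg {m : ℕ} (v : Fin (2 * m + 1) → ℝ) : 0 ≤ med (fun i => |v i|) := by
  have h := Monotone.med_comp (f := fun t => max 0 t) (fun _ _ h => max_le_max le_rfl h)
    (fun i => |v i|)
  simp only [abs_nonneg, max_eq_right] at h
  rw [h]
  exact le_max_left _ _

/-- Soft-thresholding moves each entry toward zero by its absolute value capped at `τ`. -/
theorem sub_soft {N : ℕ} (z : Fin N → ℝ) (τ : ℝ) (i : Fin N) :
    z i - soft z τ i = Real.sign (z i) * min |z i| τ := by
  have h : max (|z i| - τ) 0 = |z i| - min |z i| τ := by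
    rcases le_total |z i| τ with h | h
    · rw [max_eq_right (by linarith), min_eq_left h, sub_self]
    · rw [max_eq_left (by linarith), min_eq_right h]
  have hs : Real.sign (z i) * |z i| = z i := by
    rcases lt_trichotomy (z i) 0 with h | h | h
    · rw [Real.sign_of_neg h, abs_of_neg h]; ring
    · simp [h]
    · rw [Real.sign_of_pos h, abs_of_pos h]; ring
  unfold soft
  rw [h, mul_sub, hs]
  ring

theorem abs_sub_soft {N : ℕ} (z : Fin N → ℝ) {τ : ℝ} (hτ : 0 ≤ τ) (i : Fin N) :
    |z i - soft z τ i| = min |z i| τ := by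
  have hmin : 0 ≤ min |z i| τ := le_min (abs_nonneg _) hτ
  rw [sub_soft, abs_mul, abs_of_nonneg hmin]
  rcases lt_trichotomy (z i) 0 with h | h | h
  · simp [Real.sign_of_neg h]
  · simp [h, hτ]
  · simp [Real.sign_of_pos h]

theorem lt_abs_of_soft_ne_zero {N : ℕ} {z : Fin N → ℝ} {τ : ℝ} {i : Fin N}
    (h : soft z τ i ≠ 0) : τ < |z i| := by
  by_contra! hle
  exact h (by simp [soft, max_eq_right (sub_nonpos.2 hle)])

theorem sign_soft {N : ℕ} {z : Fin N → ℝ} {τ : ℝ} {i : Fin N} (h : soft z τ i ≠ 0) :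
    Real.sign (soft z τ i) = Real.sign (z i) := by
  have hpos : 0 < max (|z i| - τ) 0 :=
    lt_max_of_lt_left (sub_pos.2 (lt_abs_of_soft_ne_zero h))
  unfold soft
  rcases lt_trichotomy (z i) 0 with h | h | h
  · rw [Real.sign_of_neg h, Real.sign_of_neg (by linarith)]
  · simp [h]
  · rw [Real.sign_of_pos h, Real.sign_of_pos (by linarith)]

theorem stmt_0 {M m : ℕ} (A : Matrix (Fin M) (Fin (2 * m + 1)) ℝ)
    (y : Fin M → ℝ) (μ γ : ℝ) (hμ : 0 < μ) (hγ : 1 < γ)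
    (x g z : Fin (2 * m + 1) → ℝ)
    (hg : g = Aᵀ *ᵥ (A *ᵥ x - y))
    (hz : z = x - μ • g)
    (hfix : x = soft z (γ * med (fun i => |z i|)))
    (lam : ℝ) (hlam : lam = γ * med (fun i => |g i|)) :
    ∀ i, (x i ≠ 0 → -(g i) = lam * Real.sign (x i)) ∧
      (x i = 0 → |g i| ≤ lam) := by
  set τ := γ * med (fun i => |z i|)
  have hmed := med_abs_nonneg z
  have hτ : 0 ≤ τ := mul_nonneg (by linarith) hmed
  have hdiff : ∀ i, -(μ * g i) = z i - soft z τ i := fun i => by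
    rw [← congrFun hfix i, hz]
    simp
  have habs : ∀ i, μ * |g i| = min |z i| τ := fun i => by
    rw [← abs_sub_soft z hτ, ← hdiff, abs_neg, abs_mul, abs_of_pos hμ]
  have hlamτ : μ * lam = τ := by
    have hscale := Monotone.med_comp (f := fun t => μ * t)
      (fun _ _ h => mul_le_mul_of_nonneg_left h hμ.le) (fun i => |g i|)
    have hclip := Monotone.med_comp (f := fun t => min t τ)
      (fun _ _ h => min_le_min_right τ h) (fun i => |z i|)
    simp only [habs] at hscale
    rw [hscale, min_eq_left (le_mul_of_one_le_left hmed hγ.le)] at hclip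
    rw [hlam, mul_left_comm, hclip]
  intro i
  refine ⟨fun hi => ?_, fun _ => ?_⟩
  · rw [hfix] at hi
    apply mul_left_cancel₀ hμ.ne'
    rw [hfix, sign_soft hi, ← mul_assoc, hlamτ, mul_neg, hdiff, sub_soft,
      min_eq_right (lt_abs_of_soft_ne_zero hi).le, mul_comm]
  · refine le_of_mul_le_mul_left ?_ hμ
    rw [habs, hlamτ]
    exact min_le_right _ _
end

section
/- Let A ∈ ℝ^{M×N} with N = 2m+1 odd, y ∈ ℝ^M, μ > 0 and γ > 1, and let x* ∈ ℝ^N be a fixed point of the adaptive ISTA iteration with MAD thresholding, i.e. x* = soft(z*, γ·med(|z*|)) with z* = x* − μAᵀ(Ax* − y). Set λ* = γ·med(|Aᵀ(Ax* − y)|). Then x* is a global minimizer over x ∈ ℝ^N of the LASSO objective (1/2)‖y − Ax‖₂² + λ*‖x‖₁. -/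
open Matrix

/-- The median is nonnegative on nonnegative vectors. -/
theorem med_nonneg {m : ℕ} {v : Fin (2 * m + 1) → ℝ} (hv : ∀ i, 0 ≤ v i) : 0 ≤ med v := by
  have hlen : m < ((Finset.univ.val.map v).sort (· ≤ ·)).length := by
    simp
    omega
  have hmem := List.getElem_mem hlen
  rw [Multiset.mem_sort, Multiset.mem_map] at hmem
  obtain ⟨i, -, hi⟩ := hmem
  rw [med, List.getD_eq_getElem _ _ hlen, ← hi]
  exact hv i

/-- The median commutes with monotone maps. -/
theorem med_comp_of_monotone {m : ℕ} (v : Fin (2 * m + 1) → ℝ) {f : ℝ → ℝ} (hf : Monotone f) :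
    med (fun i => f (v i)) = f (med v) := by
  have hsort : (Finset.univ.val.map (fun i => f (v i))).sort (· ≤ ·)
      = ((Finset.univ.val.map v).sort (· ≤ ·)).map f := by
    refine List.Perm.eq_of_pairwise (le := (· ≤ ·)) (fun a b _ _ => le_antisymm)
      (Multiset.pairwise_sort _ _) ?_ ?_
    · exact (Multiset.pairwise_sort _ _).map f fun _ _ h => hf h
    · rw [← Multiset.coe_eq_coe, Multiset.sort_eq, ← Multiset.map_coe, Multiset.sort_eq,
        Multiset.map_map]
      rfl
  have hlen : m < ((Finset.univ.val.map v).sort (· ≤ ·)).length := by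
    simp
    omega
  rw [med, med, hsort, List.getD_eq_getElem _ _ (by simpa using hlen),
    List.getD_eq_getElem _ _ hlen, List.getElem_map]

theorem abs_sub_sign_mul_max (a : ℝ) {τ : ℝ} (hτ : 0 ≤ τ) :
    |a - Real.sign a * max (|a| - τ) 0| = min |a| τ := by
  rcases lt_trichotomy a 0 with h | rfl | h
  · rw [Real.sign_of_neg h, abs_of_neg h]
    rcases le_total (-a) τ with h' | h'
    · rw [max_eq_right (by linarith), min_eq_left h', abs_of_nonpos (by linarith)]
      ring
    · rw [max_eq_left (by linarith), min_eq_right h', abs_of_nonpos (by linarith)]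
      ring
  · simp [hτ]
  · rw [Real.sign_of_pos h, abs_of_pos h]
    rcases le_total a τ with h' | h'
    · rw [max_eq_right (by linarith), min_eq_left h', abs_of_nonneg (by linarith)]
      ring
    · rw [max_eq_left (by linarith), min_eq_right h', abs_of_nonneg (by linarith)]
      ring

theorem sub_mul_sign_mul_max (a τ : ℝ) :
    (a - Real.sign a * max (|a| - τ) 0) * (Real.sign a * max (|a| - τ) 0)
      = τ * |Real.sign a * max (|a| - τ) 0| := by
  rcases lt_trichotomy a 0 with h | rfl | h
  · rw [Real.sign_of_neg h, abs_of_neg h]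
    rcases le_total (-a) τ with h' | h'
    · simp [max_eq_right (show -a - τ ≤ 0 by linarith)]
    · rw [max_eq_left (by linarith), abs_of_nonpos (by linarith)]
      ring
  · simp
  · rw [Real.sign_of_pos h, abs_of_pos h]
    rcases le_total a τ with h' | h'
    · simp [max_eq_right (show a - τ ≤ 0 by linarith)]
    · rw [max_eq_left (by linarith), abs_of_nonneg (by linarith)]
      ring

/-- Sufficiency of the subgradient optimality conditions for the LASSO. -/
theorem lasso_le_of_subgradient {ι κ : Type*} [Fintype ι] [Fintype κ] (A : Matrix κ ι ℝ)
    (y : κ → ℝ) (x : ι → ℝ) (lam : ℝ)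
    (hbound : ∀ i, |(Aᵀ *ᵥ (A *ᵥ x - y)) i| ≤ lam)
    (halign : ∀ i, -(Aᵀ *ᵥ (A *ᵥ x - y)) i * x i = lam * |x i|) (u : ι → ℝ) :
    (1 / 2) * (∑ r, (y r - (A *ᵥ x) r) ^ 2) + lam * ∑ i, |x i|
      ≤ (1 / 2) * (∑ r, (y r - (A *ᵥ u) r) ^ 2) + lam * ∑ i, |u i| := by
  have hlin : ∑ i, (Aᵀ *ᵥ (A *ᵥ x - y)) i * (u i - x i)
      = ∑ r, ((A *ᵥ x) r - y r) * ((A *ᵥ u) r - (A *ᵥ x) r) := by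
    change (Aᵀ *ᵥ (A *ᵥ x - y)) ⬝ᵥ (u - x) = (A *ᵥ x - y) ⬝ᵥ (A *ᵥ u - A *ᵥ x)
    rw [← Matrix.mulVec_sub, Matrix.dotProduct_mulVec, Matrix.mulVec_transpose]
  have hquad : ∑ r, ((A *ᵥ x) r - y r) * ((A *ᵥ u) r - (A *ᵥ x) r)
      ≤ (1 / 2) * (∑ r, (y r - (A *ᵥ u) r) ^ 2) - (1 / 2) * (∑ r, (y r - (A *ᵥ x) r) ^ 2) := by
    rw [Finset.mul_sum, Finset.mul_sum, ← Finset.sum_sub_distrib]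
    refine Finset.sum_le_sum fun r _ => ?_
    nlinarith [sq_nonneg ((A *ᵥ u) r - (A *ᵥ x) r)]
  have hl1 : lam * ∑ i, |x i| - lam * ∑ i, |u i|
      ≤ ∑ i, (Aᵀ *ᵥ (A *ᵥ x - y)) i * (u i - x i) := by
    rw [Finset.mul_sum, Finset.mul_sum, ← Finset.sum_sub_distrib]
    refine Finset.sum_le_sum fun i _ => ?_
    have hmul := mul_le_mul_of_nonneg_right (hbound i) (abs_nonneg (u i))
    rw [← abs_mul] at hmul
    linarith [neg_abs_le ((Aᵀ *ᵥ (A *ᵥ x - y)) i * u i), halign i]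
  linarith

theorem stmt_1 {M m : ℕ} (A : Matrix (Fin M) (Fin (2 * m + 1)) ℝ)
    (y : Fin M → ℝ) (μ γ : ℝ) (hμ : 0 < μ) (hγ : 1 < γ)
    (x g z : Fin (2 * m + 1) → ℝ)
    (hg : g = Aᵀ *ᵥ (A *ᵥ x - y))
    (hz : z = x - μ • g)
    (hfix : x = soft z (γ * med (fun i => |z i|)))
    (lam : ℝ) (hlam : lam = γ * med (fun i => |g i|)) :
    ∀ u : Fin (2 * m + 1) → ℝ,
      (1 / 2) * (∑ r, (y r - (A *ᵥ x) r) ^ 2) + lam * ∑ i, |x i|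
        ≤ (1 / 2) * (∑ r, (y r - (A *ᵥ u) r) ^ 2) + lam * ∑ i, |u i| := by
  have ht : 0 ≤ med (fun i => |z i|) := med_nonneg fun i => abs_nonneg (z i)
  set t := med (fun i => |z i|) with htdef
  have hτ : 0 ≤ γ * t := by positivity
  have hx : ∀ i, x i = Real.sign (z i) * max (|z i| - γ * t) 0 := fun i => congrFun hfix i
  have hzx : ∀ i, z i - x i = -(μ * g i) := fun i => by simp [hz]
  have hmin : ∀ i, μ * |g i| = min |z i| (γ * t) := fun i => by
    rw [← abs_sub_sign_mul_max (z i) hτ, ← hx, hzx, abs_neg, abs_mul, abs_of_pos hμ]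
  have hmono : Monotone fun r : ℝ => min r (γ * t) / μ := fun a b hab => by
    dsimp only
    gcongr
  have hg_abs : (fun i => |g i|) = fun i => min |z i| (γ * t) / μ := by
    funext i
    rw [← hmin, mul_div_cancel_left₀ _ hμ.ne']
  have hμlam : μ * lam = γ * t := by
    rw [hlam, hg_abs, med_comp_of_monotone (fun i => |z i|) hmono, ← htdef,
      min_eq_left (le_mul_of_one_le_left ht hγ.le)]
    field_simp
  refine lasso_le_of_subgradient A y x lam (fun i => ?_) fun i => ?_
  · rw [← hg]
    refine le_of_mul_le_mul_left ?_ hμ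
    rw [hmin, hμlam]
    exact min_le_right _ _
  · rw [← hg]
    refine mul_left_cancel₀ hμ.ne' ?_
    have halign := sub_mul_sign_mul_max (z i) (γ * t)
    rw [← hx, hzx, ← hμlam] at halign
    linarith
end

section
/- Let A ∈ ℝ^{M×N} with N = 2m+1 odd, y ∈ ℝ^M, μ > 0, γ > 1, and c > 0. If x* ∈ ℝ^N is a fixed point of the adaptive ISTA iteration with MAD thresholding for the data y, i.e. x* = soft(x* − μAᵀ(Ax* − y), γ·med(|x* − μAᵀ(Ax* − y)|)), then c·x* is a fixed point of the same iteration (same A, μ, γ) for the scaled data c·y, i.e. c·x* = soft(cx* − μAᵀ(A(cx*) − cy), γ·med(|cx* − μAᵀ(A(cx*) − cy)|)). -/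
open Matrix

theorem Real.sign_mul_of_pos {c : ℝ} (hc : 0 < c) (a : ℝ) : Real.sign (c * a) = Real.sign a := by
  rcases lt_trichotomy a 0 with h | rfl | h
  · rw [Real.sign_of_neg h, Real.sign_of_neg (mul_neg_of_pos_of_neg hc h)]
  · simp
  · rw [Real.sign_of_pos h, Real.sign_of_pos (mul_pos hc h)]

/-- Soft-thresholding is positively homogeneous. -/
theorem soft_smul {N : ℕ} {c : ℝ} (hc : 0 < c) (z : Fin N → ℝ) (τ : ℝ) :
    soft (c • z) (c * τ) = c • soft z τ := by
  ext i
  have h : max (c * |z i| - c * τ) 0 = c * max (|z i| - τ) 0 := by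
    rw [mul_max_of_nonneg _ _ hc.le, mul_sub, mul_zero]
  simp only [soft, Pi.smul_apply, smul_eq_mul, Real.sign_mul_of_pos hc, abs_mul, abs_of_pos hc, h]
  ring

/-- The median is positively homogeneous. -/
theorem med_smul {m : ℕ} {c : ℝ} (hc : 0 < c) (v : Fin (2 * m + 1) → ℝ) :
    med (c • v) = c * med v := by
  have h : (Finset.univ.val.map (c • v)).sort (· ≤ ·) =
      ((Finset.univ.val.map v).sort (· ≤ ·)).map (c * ·) := by
    rw [Multiset.map_sort (r' := (· ≤ ·)) (f := (c * ·))
      (hs := fun a _ b _ => (mul_le_mul_iff_right₀ hc).symm), Multiset.map_map]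
    rfl
  rw [med, med, h]
  conv_lhs => rw [← mul_zero c]
  exact List.getD_map _ 0 (c * ·)

theorem stmt_2 {M m : ℕ} (A : Matrix (Fin M) (Fin (2 * m + 1)) ℝ)
    (y : Fin M → ℝ) (μ γ c : ℝ) (hμ : 0 < μ) (hγ : 1 < γ) (hc : 0 < c)
    (x : Fin (2 * m + 1) → ℝ)
    (hfix : x = soft (x - μ • (Aᵀ *ᵥ (A *ᵥ x - y)))
      (γ * med (fun i => |(x - μ • (Aᵀ *ᵥ (A *ᵥ x - y))) i|))) :
    c • x = soft (c • x - μ • (Aᵀ *ᵥ (A *ᵥ (c • x) - c • y)))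
      (γ * med (fun i => |(c • x - μ • (Aᵀ *ᵥ (A *ᵥ (c • x) - c • y))) i|)) := by
  have hz : c • x - μ • (Aᵀ *ᵥ (A *ᵥ (c • x) - c • y)) =
      c • (x - μ • (Aᵀ *ᵥ (A *ᵥ x - y))) := by
    rw [mulVec_smul, ← smul_sub, mulVec_smul, smul_comm μ c, ← smul_sub]
  rw [hz]
  set z := x - μ • (Aᵀ *ᵥ (A *ᵥ x - y))
  have habs : (fun i => |(c • z) i|) = c • fun i => |z i| := by
    ext i
    simp [abs_mul, abs_of_pos hc]
  rw [habs, med_smul hc, mul_left_comm, soft_smul hc, ← hfix]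
end

section
/- Let N = 2m+1 be odd, γ > 1, and z ∈ ℝ^N, and set T(z) = soft(z, γ·med(|z|)). Then the number of indices i with T(z)_i ≠ 0 is at most m; in particular the size of the support of T(z) is smaller than N/2. -/
open Matrix

theorem List.countP_getElem_lt_le {α : Type*} [LinearOrder α] {l : List α}
    (hl : l.Pairwise (· ≤ ·)) {k : ℕ} (hk : k < l.length) :
    l.countP (fun x => l[k] < x) ≤ l.length - (k + 1) := by
  have htake : (l.take (k + 1)).countP (fun x => l[k] < x) = 0 := by
    rw [List.countP_eq_zero]
    intro x hx
    obtain ⟨i, hi, rfl⟩ := List.mem_iff_getElem.mp hx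
    rw [List.length_take] at hi
    have hik : i ≤ k := by omega
    rw [List.getElem_take, decide_eq_true_eq, not_lt]
    rcases hik.eq_or_lt with rfl | hlt
    · exact le_rfl
    · exact List.pairwise_iff_getElem.mp hl i k _ hk hlt
  calc l.countP (fun x => l[k] < x)
      = (l.take (k + 1) ++ l.drop (k + 1)).countP (fun x => l[k] < x) := by
        rw [List.take_append_drop]
    _ = (l.drop (k + 1)).countP (fun x => l[k] < x) := by
        rw [List.countP_append, htake, zero_add]
    _ ≤ l.length - (k + 1) := by
        rw [← List.length_drop]
        exact List.countP_le_length

theorem med_eq_getElem {m : ℕ} (v : Fin (2 * m + 1) → ℝ) :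
    ∃ h : m < ((Finset.univ.val.map v).sort (· ≤ ·)).length,
      med v = ((Finset.univ.val.map v).sort (· ≤ ·))[m] := by
  have h : m < ((Finset.univ.val.map v).sort (· ≤ ·)).length := by
    rw [Multiset.length_sort, Multiset.card_map, Finset.card_val, Finset.card_univ, Fintype.card_fin]
    omega
  exact ⟨h, List.getD_eq_getElem _ _ h⟩

theorem exists_eq_med {m : ℕ} (v : Fin (2 * m + 1) → ℝ) : ∃ i, v i = med v := by
  obtain ⟨h, hmed⟩ := med_eq_getElem v
  have hmem := List.getElem_mem h
  rw [← hmed, Multiset.mem_sort, Multiset.mem_map] at hmem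
  obtain ⟨i, -, hi⟩ := hmem
  exact ⟨i, hi⟩

theorem card_filter_med_lt_le {m : ℕ} (v : Fin (2 * m + 1) → ℝ) :
    (Finset.univ.filter (fun i => med v < v i)).card ≤ m := by
  obtain ⟨h, hmed⟩ := med_eq_getElem v
  have hcount := List.countP_getElem_lt_le
    (Multiset.pairwise_sort (Finset.univ.val.map v) (· ≤ ·)) h
  rw [← hmed, ← Multiset.coe_countP, Multiset.sort_eq, Multiset.countP_map] at hcount
  have hlen : ((Finset.univ.val.map v).sort (· ≤ ·)).length = 2 * m + 1 := by simp
  rw [hlen] at hcount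
  refine le_trans hcount ?_
  omega

theorem stmt_4 {m : ℕ} (γ : ℝ) (hγ : 1 < γ) (z : Fin (2 * m + 1) → ℝ) :
    (Finset.univ.filter
      (fun i => soft z (γ * med (fun k => |z k|)) i ≠ 0)).card ≤ m := by
  refine le_trans (Finset.card_le_card ?_) (card_filter_med_lt_le (fun k => |z k|))
  obtain ⟨j, hj⟩ := exists_eq_med (fun k => |z k|)
  have hmed : 0 ≤ med (fun k => |z k|) := hj ▸ abs_nonneg (z j)
  refine Finset.monotone_filter_right _ fun i _ hi => ?_
  exact (le_mul_of_one_le_left hmed hγ.le).trans_lt (lt_abs_of_soft_ne_zero hi)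
end

section
/- Let N = 2m+1 be odd and let w, w' ∈ ℝ^N be vectors with nonnegative entries. Suppose S is a set of indices with |S| ≤ m such that w_i = w'_i for all i ∉ S, and such that w_i ≥ w_j and w'_i ≥ w'_j for every i ∈ S and every j ∉ S. Then the (m+1)-th smallest entry of w equals the (m+1)-th smallest entry of w'; moreover this common median value equals w_j for some index j ∉ S. -/
/-- If at most `m` entries, indexed by `S`, dominate all others, the median is computed on `Sᶜ`. -/
theorem med_eq_getD_sort_compl {m : ℕ} (v : Fin (2 * m + 1) → ℝ)
    (S : Finset (Fin (2 * m + 1))) (hS : S.card ≤ m)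
    (hge : ∀ i ∈ S, ∀ j ∉ S, v j ≤ v i) :
    med v = ((Sᶜ.val.map v).sort (· ≤ ·)).getD m 0 := by
  have hsplit : (Finset.univ.val.map v).sort (· ≤ ·) =
      (Sᶜ.val.map v).sort (· ≤ ·) ++ (S.val.map v).sort (· ≤ ·) := by
    refine List.Perm.eq_of_pairwise' (r := (· ≤ ·)) (Multiset.pairwise_sort _ _) ?_ ?_
    · refine List.pairwise_append.2
        ⟨Multiset.pairwise_sort _ _, Multiset.pairwise_sort _ _, fun a ha b hb => ?_⟩
      simp only [Multiset.mem_sort, Multiset.mem_map, Finset.mem_val, Finset.mem_compl] at ha hb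
      obtain ⟨j, hj, rfl⟩ := ha
      obtain ⟨i, hi, rfl⟩ := hb
      exact hge i hi j hj
    · rw [← Multiset.coe_eq_coe, ← Multiset.coe_add]
      simp only [Multiset.sort_eq]
      rw [← Multiset.map_add, ← Finset.disjUnion_val Sᶜ S disjoint_compl_left,
        Finset.disjUnion_eq_union, Finset.union_comm, Finset.union_compl]
  have hcard : m < ((Sᶜ.val.map v).sort (· ≤ ·)).length := by
    simp [Finset.card_compl]
    omega
  rw [med, hsplit, List.getD_append _ _ _ _ hcard]

theorem stmt_8 {m : ℕ} (w w' : Fin (2 * m + 1) → ℝ)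
    (hw : ∀ i, 0 ≤ w i) (hw' : ∀ i, 0 ≤ w' i)
    (S : Finset (Fin (2 * m + 1))) (hS : S.card ≤ m)
    (heq : ∀ i ∉ S, w i = w' i)
    (hge : ∀ i ∈ S, ∀ j ∉ S, w j ≤ w i ∧ w' j ≤ w' i) :
    med w = med w' ∧ ∃ j ∉ S, med w = w j := by
  have hcard : m < ((Sᶜ.val.map w).sort (· ≤ ·)).length := by
    simp [Finset.card_compl]
    omega
  rw [med_eq_getD_sort_compl w S hS fun i hi j hj => (hge i hi j hj).1,
    med_eq_getD_sort_compl w' S hS fun i hi j hj => (hge i hi j hj).2]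
  refine ⟨?_, ?_⟩
  · rw [Multiset.map_congr rfl fun i hi => heq i (Finset.mem_compl.1 hi)]
  · rw [List.getD_eq_getElem _ _ hcard]
    have hmem := List.getElem_mem hcard
    rw [Multiset.mem_sort, Multiset.mem_map] at hmem
    obtain ⟨j, hj, hjw⟩ := hmem
    exact ⟨j, Finset.mem_compl.1 hj, hjw.symm⟩
end

section
/- Let A ∈ ℝ^{M×N}, y ∈ ℝ^M, λ ∈ ℝ, I a subset of column indices of A such that A_Iᵀ A_I is invertible, and s ∈ ℝ^{|I|}. Let x ∈ ℝ^N be the vector with x_i = 0 for i ∉ I and x_I = (A_Iᵀ A_I)^{-1}(A_Iᵀ y − λ s). Then for every column index j of A, −A_jᵀ(Ax − y) = a·λ + b, where a = A_jᵀ A_I (A_Iᵀ A_I)^{-1} s and b = A_jᵀ (I_M − A_I (A_Iᵀ A_I)^{-1} A_Iᵀ) y. In particular, λ ↦ −A_jᵀ(Ax(λ) − y) is an affine function of λ as long as I, s and j are unchanged. -/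
open Matrix

/-- Multiplying by a vector supported on `I` only involves the columns indexed by `I`. -/
theorem mulVec_eq_submatrix_mulVec_of_support {m n R : Type*} [Fintype n] [DecidableEq n]
    [NonUnitalNonAssocSemiring R] (A : Matrix m n R) (I : Finset n) (x : n → R)
    (hx : ∀ i, i ∉ I → x i = 0) :
    A *ᵥ x = A.submatrix id (Subtype.val : I → n) *ᵥ fun i => x i := by
  ext r
  simp only [mulVec, dotProduct, submatrix_apply, id_eq]
  rw [Finset.sum_coe_sort I (fun i => A r i * x i)]
  exact (Finset.sum_subset (Finset.subset_univ I) fun i _ hi => by simp [hx i hi]).symm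

theorem stmt_10 {M N : ℕ} (A : Matrix (Fin M) (Fin N) ℝ) (y : Fin M → ℝ) (lam : ℝ)
    (I : Finset (Fin N))
    (AI : Matrix (Fin M) I ℝ) (hAI : AI = fun r c => A r c.1)
    (hInv : IsUnit (AIᵀ * AI))
    (s : I → ℝ) (x : Fin N → ℝ)
    (hx : ∀ i, x i = if h : i ∈ I then
      ((AIᵀ * AI)⁻¹ *ᵥ (AIᵀ *ᵥ y - lam • s)) ⟨i, h⟩ else 0)
    (j : Fin N) (a b : ℝ)
    (ha : a = (fun r => A r j) ⬝ᵥ (AI *ᵥ ((AIᵀ * AI)⁻¹ *ᵥ s)))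
    (hb : b = (fun r => A r j) ⬝ᵥ (y - AI *ᵥ ((AIᵀ * AI)⁻¹ *ᵥ (AIᵀ *ᵥ y)))) :
    -((Aᵀ *ᵥ (A *ᵥ x - y)) j) = a * lam + b := by
  have hxI : (fun i : I => x i) = (AIᵀ * AI)⁻¹ *ᵥ (AIᵀ *ᵥ y - lam • s) := by
    ext i
    simp [hx]
  have hAx : A *ᵥ x = AI *ᵥ ((AIᵀ * AI)⁻¹ *ᵥ (AIᵀ *ᵥ y - lam • s)) := by
    rw [mulVec_eq_submatrix_mulVec_of_support A I x fun i hi => by simp [hx, hi], hxI, hAI]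
    rfl
  have hj : (Aᵀ *ᵥ (A *ᵥ x - y)) j = (fun r => A r j) ⬝ᵥ (A *ᵥ x - y) := rfl
  rw [hj, hAx, ha, hb]
  simp only [mulVec_sub, mulVec_smul, dotProduct_sub, dotProduct_smul, smul_eq_mul]
  ring
end

section
/- Let C be a real symmetric positive definite n×n matrix and u, v ∈ ℝⁿ. If every complex eigenvalue of the (generally nonsymmetric) matrix C + u vᵀ has positive real part, then 1 + vᵀ C^{-1} u > 0. -/
open Matrix

/-- A real matrix whose complex eigenvalues have positive real part has positive determinant. -/
theorem Matrix.det_pos_of_re_pos {m : Type*} [Fintype m] [DecidableEq m] (A : Matrix m m ℝ)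
    (h : ∀ μ : ℂ, (A.map (algebraMap ℝ ℂ)).charpoly.IsRoot μ → 0 < μ.re) : 0 < A.det := by
  have key : 0 < (-A).charpoly.eval 0 := by
    refine Polynomial.zero_lt_eval_of_roots_lt_of_leadingCoeff_nonneg (fun t h0 ↦ ?_)
      (by simp [(-A).charpoly_monic.leadingCoeff])
    replace h0 : (-A).charpoly.eval t = 0 := h0
    have hroot : A.charpoly.eval (-t) = 0 := by
      rw [eval_charpoly] at h0 ⊢
      rw [show scalar m (-t) - A = -(scalar m t - -A) by rw [map_neg]; abel, det_neg, h0, mul_zero]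
    have hpos := h ((-t : ℝ) : ℂ) (by
      rw [show A.map (algebraMap ℝ ℂ) = (algebraMap ℝ ℂ).mapMatrix A from rfl]
      rw [RingHom.mapMatrix_apply, charpoly_map]
      exact Polynomial.IsRoot.map hroot)
    rw [Complex.ofReal_re] at hpos
    linarith
  simpa [eval_charpoly] using key

theorem stmt_13 {n : ℕ} (C : Matrix (Fin n) (Fin n) ℝ) (hC : C.PosDef)
    (u v : Fin n → ℝ)
    (h : ∀ μ : ℂ,
      ((C + Matrix.vecMulVec u v).map (algebraMap ℝ ℂ)).charpoly.IsRoot μ → 0 < μ.re) :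
    0 < 1 + v ⬝ᵥ (C⁻¹ *ᵥ u) := by
  have hdet := det_pos_of_re_pos _ h
  rw [vecMulVec_eq Unit, det_add_replicateCol_mul_replicateRow hC.det_pos.ne'.isUnit] at hdet
  have hpos := pos_of_mul_pos_right hdet hC.det_pos.le
  rw [det_unique] at hpos
  simpa [Matrix.mul_assoc, Matrix.mul_apply, dotProduct, mulVec] using hpos
end

section
/- Let A ∈ ℝ^{M×N} with N = 2m+1 odd, y ∈ ℝ^M, μ > 0 and γ ≥ 1. Given x ∈ ℝ^N, set z = x − μAᵀ(Ax − y), let j be an index with |z_j| = med(|z|), define d ∈ ℝ^N by d_i = 1 if z_i > γ|z_j|, d_i = −1 if z_i < −γ|z_j|, and d_i = 0 if |z_i| ≤ γ|z_j|, and set D = diag(d). Let x' = soft(z, γ·med(|z|)) and z' = x' − μAᵀ(Ax' − y). Then z' = B z + μAᵀy, where B = (I − μAᵀA)(D² − γ·sign(z_j)·d e_jᵀ). -/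
open Matrix

theorem real_sign_mul_self (t : ℝ) : Real.sign t * t = |t| := by
  rcases lt_trichotomy t 0 with h | h | h
  · rw [Real.sign_of_neg h, abs_of_neg h]; ring
  · simp [h]
  · rw [Real.sign_of_pos h, abs_of_pos h]; ring

theorem soft_eq_sq_mul_sub {t τ δ : ℝ} (hτ : 0 ≤ τ)
    (hδ : δ = if τ < t then 1 else if t < -τ then -1 else 0) :
    Real.sign t * max (|t| - τ) 0 = δ ^ 2 * t - δ * τ := by
  subst hδ
  split_ifs with h₁ h₂
  · have ht : 0 < t := hτ.trans_lt h₁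
    rw [Real.sign_of_pos ht, abs_of_pos ht, max_eq_left (by linarith)]; ring
  · have ht : t < 0 := by linarith
    rw [Real.sign_of_neg ht, abs_of_neg ht, max_eq_left (by linarith)]; ring
  · have ht : |t| ≤ τ := abs_le.2 ⟨not_lt.1 h₂, not_lt.1 h₁⟩
    rw [max_eq_right (by linarith)]; ring

theorem stmt_17 {M m : ℕ} (A : Matrix (Fin M) (Fin (2 * m + 1)) ℝ) (y : Fin M → ℝ)
    (μ γ : ℝ) (hμ : 0 < μ) (hγ : 1 ≤ γ)
    (x z : Fin (2 * m + 1) → ℝ)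
    (hz : z = x - μ • (Aᵀ *ᵥ (A *ᵥ x - y)))
    (j : Fin (2 * m + 1)) (hj : |z j| = med (fun k => |z k|))
    (d : Fin (2 * m + 1) → ℝ)
    (hd : ∀ i, d i = if γ * |z j| < z i then 1
      else if z i < -(γ * |z j|) then -1 else 0)
    (x' z' : Fin (2 * m + 1) → ℝ)
    (hx' : x' = soft z (γ * med (fun k => |z k|)))
    (hz' : z' = x' - μ • (Aᵀ *ᵥ (A *ᵥ x' - y)))
    (B : Matrix (Fin (2 * m + 1)) (Fin (2 * m + 1)) ℝ)
    (hB : B = (1 - μ • (Aᵀ * A)) *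
      (Matrix.diagonal d ^ 2
        - (γ * Real.sign (z j)) • Matrix.vecMulVec d (Pi.single j 1))) :
    z' = B *ᵥ z + μ • (Aᵀ *ᵥ y) := by
  have hx : x' = (Matrix.diagonal d ^ 2
      - (γ * Real.sign (z j)) • Matrix.vecMulVec d (Pi.single j 1)) *ᵥ z := by
    ext i
    have hτ : 0 ≤ γ * |z j| := mul_nonneg (by linarith) (abs_nonneg _)
    rw [hx', ← hj, soft, soft_eq_sq_mul_sub hτ (hd i), ← real_sign_mul_self (z j)]
    simp only [sub_mulVec, smul_mulVec, vecMulVec_mulVec, diagonal_pow, mulVec_diagonal, Pi.sub_apply, Pi.smul_apply,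
      Pi.pow_apply, single_one_dotProduct, MulOpposite.smul_eq_mul_unop, MulOpposite.unop_op,
      smul_eq_mul]
    ring
  rw [hz', hB, ← mulVec_mulVec, ← hx, sub_mulVec, one_mulVec, smul_mulVec, ← mulVec_mulVec,
    mulVec_sub, smul_sub]
  abel
end
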